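/- The quotient ring ℚ[x,y]/⟨8x³ + 24xy, x⁴ + 22x²y + 9y²⟩ is a ℚ-vector space of dimension 6; moreover the images of the monomials 1, x, y, x², xy, x²y form a ℚ-basis of it. -/

import Mathlib

open MvPolynomial

/-- The variable `x` of `ℚ[x,y]`. -/
noncomputable def xVar : MvPolynomial (Fin 2) ℚ := X 0
/-- The variable `y` of `ℚ[x,y]`. -/
noncomputable def yVar : MvPolynomial (Fin 2) ℚ := X 1

/-- The ideal `⟨8x³ + 24xy, x⁴ + 22x²y + 9y²⟩` of `ℚ[x,y]` (the relations `r₂`, `s₂`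
of Kiem–Moon's presentation (2.5) for `n = 2`, written with `y = α²`). -/
noncomputable def relIdeal : Ideal (MvPolynomial (Fin 2) ℚ) :=
  Ideal.span ({8 * xVar ^ 3 + 24 * xVar * yVar,
    xVar ^ 4 + 22 * xVar ^ 2 * yVar + 9 * yVar ^ 2} : Set (MvPolynomial (Fin 2) ℚ))

/-- The images of the monomials `1, x, y, x², xy, x²y` in the quotient ring. -/
noncomputable def basisFam : Fin 6 → (MvPolynomial (Fin 2) ℚ ⧸ relIdeal) :=
  ![Ideal.Quotient.mk relIdeal 1,
    Ideal.Quotient.mk relIdeal xVar,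
    Ideal.Quotient.mk relIdeal yVar,
    Ideal.Quotient.mk relIdeal (xVar ^ 2),
    Ideal.Quotient.mk relIdeal (xVar * yVar),
    Ideal.Quotient.mk relIdeal (xVar ^ 2 * yVar)]

def matA : Matrix (Fin 6) (Fin 6) ℚ :=
  !![0,0,0,0,0,0; 1,0,0,0,0,0; 0,0,0,0,0,0; 0,1,0,0,0,0; 0,0,1,-3,0,0; 0,0,0,0,1,0]
def matB : Matrix (Fin 6) (Fin 6) ℚ :=
  !![0,0,0,0,0,0; 0,0,0,0,0,0; 1,0,0,0,0,0; 0,0,0,0,0,0; 0,1,0,0,0,0; 0,0,-19/9,1,0,0]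

theorem matAB : matA * matB = matB * matA := by decide +kernel

theorem mat_rel1 : 8 * matA ^ 3 + 24 * matA * matB = 0 := by
  decide +kernel

theorem mat_rel2 : matA ^ 4 + 22 * matA ^ 2 * matB + 9 * matB ^ 2 = 0 := by
  decide +kernel

theorem mat_comm : ∀ a ∈ ({matA, matB} : Set (Matrix (Fin 6) (Fin 6) ℚ)),
    ∀ b ∈ ({matA, matB} : Set (Matrix (Fin 6) (Fin 6) ℚ)), a * b = b * a := by
  rintro a (rfl | rfl) b (rfl | rfl)
  · rfl
  · exact matAB
  · exact matAB.symm
  · rfl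

theorem exists_map : ∃ f : MvPolynomial (Fin 2) ℚ →ₐ[ℚ] Matrix (Fin 6) (Fin 6) ℚ,
    f xVar = matA ∧ f yVar = matB := by
  let _ : CommRing (Algebra.adjoin ℚ ({matA, matB} : Set (Matrix (Fin 6) (Fin 6) ℚ))) :=
    Algebra.adjoinCommRingOfComm ℚ mat_comm
  let a : Algebra.adjoin ℚ ({matA, matB} : Set (Matrix (Fin 6) (Fin 6) ℚ)) :=
    ⟨matA, Algebra.subset_adjoin (by simp)⟩
  let b : Algebra.adjoin ℚ ({matA, matB} : Set (Matrix (Fin 6) (Fin 6) ℚ)) :=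
    ⟨matB, Algebra.subset_adjoin (by simp)⟩
  refine ⟨(Subalgebra.val _).comp (aeval ![a, b]), ?_, ?_⟩
  · simp [xVar, a]
  · simp [yVar, b]

theorem exists_quot_map : ∃ f : (MvPolynomial (Fin 2) ℚ ⧸ relIdeal) →ₐ[ℚ] Matrix (Fin 6) (Fin 6) ℚ,
    f (Ideal.Quotient.mk relIdeal xVar) = matA ∧ f (Ideal.Quotient.mk relIdeal yVar) = matB := by
  obtain ⟨f, hx, hy⟩ := exists_map
  have hk : relIdeal ≤ RingHom.ker f := by
    rw [relIdeal, Ideal.span_le]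
    rintro p (rfl | rfl)
    · simp only [SetLike.mem_coe, RingHom.mem_ker, map_add, map_mul, map_pow, map_ofNat, hx, hy]
      exact mat_rel1
    · simp only [SetLike.mem_coe, RingHom.mem_ker, map_add, map_mul, map_pow, map_ofNat, hx, hy]
      exact mat_rel2
  exact ⟨Ideal.Quotient.liftₐ relIdeal f (fun a ha => hk ha), hx, hy⟩

theorem basis_li : LinearIndependent ℚ basisFam := by
  obtain ⟨f, hx, hy⟩ := exists_quot_map
  let L : Matrix (Fin 6) (Fin 6) ℚ →ₗ[ℚ] (Fin 6 → ℚ) :=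
    { toFun := fun M i => M i 0
      map_add' := fun _ _ => rfl
      map_smul' := fun _ _ => rfl }
  apply LinearIndependent.of_comp (L.comp f.toLinearMap)
  have : (L.comp f.toLinearMap) ∘ basisFam = fun i => Pi.single i (1 : ℚ) := by
    funext i
    fin_cases i
    · change L (f (Ideal.Quotient.mk relIdeal 1)) = _
      rw [map_one, map_one]; change (fun i => _) = _; decide +kernel
    · change L (f (Ideal.Quotient.mk relIdeal xVar)) = _
      rw [hx]; change (fun i => _) = _; decide +kernel
    · change L (f (Ideal.Quotient.mk relIdeal yVar)) = _
      rw [hy]; change (fun i => _) = _; decide +kernel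
    · change L (f (Ideal.Quotient.mk relIdeal (xVar ^ 2))) = _
      rw [map_pow, map_pow, hx]; change (fun i => _) = _; decide +kernel
    · change L (f (Ideal.Quotient.mk relIdeal (xVar * yVar))) = _
      rw [map_mul, map_mul, hx, hy]; change (fun i => _) = _; decide +kernel
    · change L (f (Ideal.Quotient.mk relIdeal (xVar ^ 2 * yVar))) = _
      rw [map_mul, map_mul, map_pow, map_pow, hx, hy]; change (fun i => _) = _; decide +kernel
  rw [this]
  exact Pi.linearIndependent_single_one (Fin 6) ℚ

theorem basis_span : Submodule.span ℚ (Set.range basisFam) = ⊤ := by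
  set S := Submodule.span ℚ (Set.range basisFam) with hS
  have hb : ∀ i, basisFam i ∈ S := fun i => Submodule.subset_span ⟨i, rfl⟩
  obtain ⟨x, hx⟩ : ∃ x, x = Ideal.Quotient.mk relIdeal xVar := ⟨_, rfl⟩
  obtain ⟨y, hy⟩ : ∃ y, y = Ideal.Quotient.mk relIdeal yVar := ⟨_, rfl⟩
  have hd : ∀ (a : ℚ) (z : MvPolynomial (Fin 2) ℚ ⧸ relIdeal),
      a • z = Ideal.Quotient.mk relIdeal (C a) * z := fun a z => Algebra.smul_def a z
  have h0 : (1 : MvPolynomial (Fin 2) ℚ ⧸ relIdeal) ∈ S := hb 0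
  have h1 : x ∈ S := hx ▸ hb 1
  have h2 : y ∈ S := hy ▸ hb 2
  have h3 : x ^ 2 ∈ S := by rw [hx, ← map_pow]; exact hb 3
  have h4 : x * y ∈ S := by rw [hx, hy, ← map_mul]; exact hb 4
  have h5 : x ^ 2 * y ∈ S := by rw [hx, hy, ← map_pow, ← map_mul]; exact hb 5
  have r1 : 8 * x ^ 3 + 24 * x * y = 0 := by
    have : Ideal.Quotient.mk relIdeal (8 * xVar ^ 3 + 24 * xVar * yVar) = 0 :=
      Ideal.Quotient.eq_zero_iff_mem.2 (Ideal.subset_span (by simp))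
    simpa only [map_add, map_mul, map_pow, map_ofNat, ← hx, ← hy] using this
  have r2 : x ^ 4 + 22 * x ^ 2 * y + 9 * y ^ 2 = 0 := by
    have : Ideal.Quotient.mk relIdeal (xVar ^ 4 + 22 * xVar ^ 2 * yVar + 9 * yVar ^ 2) = 0 :=
      Ideal.Quotient.eq_zero_iff_mem.2 (Ideal.subset_span (by simp))
    simpa only [map_add, map_mul, map_pow, map_ofNat, ← hx, ← hy] using this
  have cancel : ∀ (n : ℚ) (_ : n ≠ 0) (z : MvPolynomial (Fin 2) ℚ ⧸ relIdeal),
      n • z = 0 → z = 0 := fun n hn z hz => (smul_eq_zero.1 hz).resolve_left hn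
  have e1 : x ^ 3 = (-3 : ℚ) • (x * y) := by
    rw [← sub_eq_zero]
    apply cancel 8 (by norm_num)
    simp only [hd, map_ofNat, map_neg]
    linear_combination r1
  have e2 : y ^ 2 = (-19/9 : ℚ) • (x ^ 2 * y) := by
    rw [← sub_eq_zero]
    apply cancel 9 (by norm_num)
    rw [smul_sub, smul_smul]
    norm_num
    simp only [hd, map_ofNat, map_neg] at e1 ⊢
    linear_combination r2 - x * e1
  have e3 : x ^ 3 * y = 0 := by
    apply cancel 16 (by norm_num)
    have e2' : (9 : ℚ) • y ^ 2 = (-19 : ℚ) • (x ^ 2 * y) := by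
      rw [e2, smul_smul]; norm_num
    simp only [hd, map_ofNat, map_neg] at e1 e2' ⊢
    linear_combination x * e2' - 3 * y * e1
  have e4 : x * y ^ 2 = 0 := by
    rw [e2, mul_smul_comm, show x * (x ^ 2 * y) = x ^ 3 * y by ring, e3, smul_zero]
  have hgen : ∀ z, (∀ i, z * basisFam i ∈ S) → ∀ s ∈ S, z * s ∈ S := by
    intro z hz s hs
    have : S ≤ S.comap (LinearMap.mulLeft ℚ z) := by
      conv_lhs => rw [hS]
      rw [Submodule.span_le]
      rintro _ ⟨i, rfl⟩
      exact hz i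
    exact this hs
  have b : basisFam = ![1, x, y, x ^ 2, x * y, x ^ 2 * y] := by
    simp only [basisFam, map_one, map_mul, map_pow, hx, hy]
  have hX : ∀ s ∈ S, x * s ∈ S := by
    apply hgen
    rw [b]
    intro i
    fin_cases i
    · change x * 1 ∈ S; simpa using h1
    · change x * x ∈ S; rwa [← pow_two]
    · exact h4
    · change x * x ^ 2 ∈ S
      rw [show x * x ^ 2 = x ^ 3 by ring, e1]; exact S.smul_mem _ h4
    · change x * (x * y) ∈ S
      rwa [show x * (x * y) = x ^ 2 * y by ring]
    · change x * (x ^ 2 * y) ∈ S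
      rw [show x * (x ^ 2 * y) = x ^ 3 * y by ring, e3]; exact S.zero_mem
  have hY : ∀ s ∈ S, y * s ∈ S := by
    apply hgen
    rw [b]
    intro i
    fin_cases i
    · change y * 1 ∈ S; simpa using h2
    · change y * x ∈ S; rwa [mul_comm]
    · change y * y ∈ S
      rw [← pow_two, e2]; exact S.smul_mem _ h5
    · change y * x ^ 2 ∈ S
      rwa [mul_comm]
    · change y * (x * y) ∈ S
      rw [show y * (x * y) = x * y ^ 2 by ring, e4]; exact S.zero_mem
    · change y * (x ^ 2 * y) ∈ S
      rw [show y * (x ^ 2 * y) = x * (x * y ^ 2) by ring, e4, mul_zero]; exact S.zero_mem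
  rw [eq_top_iff]
  rintro q -
  obtain ⟨p, rfl⟩ := Ideal.Quotient.mk_surjective q
  induction p using MvPolynomial.induction_on with
  | C a =>
    have : Ideal.Quotient.mk relIdeal (C a) = a • (1 : MvPolynomial (Fin 2) ℚ ⧸ relIdeal) := by
      rw [hd, mul_one]
    rw [this]; exact S.smul_mem _ h0
  | add p q hp hq => rw [map_add]; exact S.add_mem hp hq
  | mul_X p i hp =>
    rw [map_mul, mul_comm]
    fin_cases i
    · have := hX _ hp
      rwa [hx] at this
    · have := hY _ hp
      rwa [hy] at this

/-- The quotient ring `ℚ[x,y]/⟨8x³ + 24xy, x⁴ + 22x²y + 9y²⟩` — the rational cohomology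
ring `H*(M̄₀,₀(ℙ¹,3);ℚ)` by Kiem–Moon, Theorem 1.4(2) — is a `ℚ`-vector space of
dimension 6, and the images of `1, x, y, x², xy, x²y` form a `ℚ`-basis of it. -/
theorem stmt8 :
    FiniteDimensional ℚ (MvPolynomial (Fin 2) ℚ ⧸ relIdeal) ∧
    Module.finrank ℚ (MvPolynomial (Fin 2) ℚ ⧸ relIdeal) = 6 ∧
    LinearIndependent ℚ basisFam ∧
    Submodule.span ℚ (Set.range basisFam) = ⊤ := by
  have hB := Module.finrank_eq_card_basis (Module.Basis.mk basis_li basis_span.ge)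
  refine ⟨Module.Finite.of_basis (Module.Basis.mk basis_li basis_span.ge), ?_, basis_li, basis_span⟩
  simpa using hB
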